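/- arXiv:1104.4557 — 2 statements merged into one kernel-verified Lean document; each statement's English description precedes it below -/
import Mathlib

section
/- Let p be prime and k a divisor of p-1. The least k-th power non-residue in the arithmetic progression {bn + c : n = 0, 1, 2, ...} over F_p (assuming such a non-residue exists in the progression) is at most (7/√5)·b·√((p-1)/k) + 4b + c. -/
open Polynomial in
/-- Weights on a set of `u + 1` points that extract the coefficient of `X ^ u` from a polynomial of
degree at most `u`. -/
theorem exists_weights_coeff {F : Type*} [Field F] {A : Finset F} {u : ℕ} (hA : A.card = u + 1) :
    ∃ w : F → F, ∀ (b : F) (j : ℕ), j ≤ u →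
      ∑ a ∈ A, w a * (a + b) ^ j = if j = u then 1 else 0 := by
  classical
  refine ⟨fun a => (∏ a' ∈ A.erase a, (a - a'))⁻¹, fun b j hj => ?_⟩
  have hdeg : ((X + C b : F[X]) ^ j).degree < A.card := by
    rw [degree_pow, degree_X_add_C, hA]
    simp only [nsmul_eq_mul, mul_one]
    exact_mod_cast Nat.lt_succ_of_le hj
  have h := Lagrange.coeff_eq_sum (s := A) (v := id) Function.injective_id.injOn hdeg
  simp only [hA, Nat.add_sub_cancel, coeff_X_add_C_pow, id, eval_pow, eval_add, eval_X,
    eval_C] at h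
  simp only [inv_mul_eq_div, ← h]
  rcases hj.lt_or_eq with hj | rfl
  · simp [hj.ne, Nat.choose_eq_zero_of_lt hj]
  · simp

open Polynomial in
/-- A weak form of the Hanson–Petridis bound for sumsets inside a coset of the `m`-th roots of
unity together with zero. -/
theorem mul_card_le_of_add_pow_succ {F : Type*} [Field F] {A B : Finset F} {m u : ℕ} {ε : F}
    (hm : 0 < m) (hA : A.card = u + 1) (hchoose : ((m + u).choose m : F) ≠ 0)
    (h : ∀ a ∈ A, ∀ b ∈ B, (a + b) ^ (m + 1) = ε * (a + b)) :
    B.card * u ≤ m := by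
  classical
  obtain ⟨w, hw⟩ := exists_weights_coeff hA
  set P : F[X] := ∑ a ∈ A, C (w a) * (X + C a) ^ (m + u) - C ε with hP
  have hcoeff (j : ℕ) (hj : m ≤ j) :
      P.coeff j = if j = m then ((m + u).choose m : F) else 0 := by
    have hj0 : j ≠ 0 := by omega
    simp only [hP, coeff_sub, finsetSum_coeff, coeff_C_mul, coeff_X_add_C_pow, coeff_C, hj0,
      if_false, sub_zero, ← mul_assoc, ← Finset.sum_mul]
    have hs := hw 0 (m + u - j) (by omega)
    simp only [add_zero] at hs
    rw [hs]
    rcases hj.eq_or_lt with rfl | hj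
    · simp
    · rcases le_or_gt j (m + u) with hju | hju
      · rw [if_neg (by omega), if_neg hj.ne', zero_mul]
      · simp [Nat.choose_eq_zero_of_lt hju, hj.ne']
  have hP0 : P ≠ 0 := by
    intro h0
    have := hcoeff m le_rfl
    simp only [h0, coeff_zero, if_true] at this
    exact hchoose this.symm
  have hPdeg : P.natDegree ≤ m := by
    rw [natDegree_le_iff_coeff_eq_zero]
    intro j hj
    rw [hcoeff j hj.le, if_neg hj.ne']
  have hpow (y : F) (hy : y ^ (m + 1) = ε * y) (i : ℕ) (hi : 0 < i) :
      y ^ (m + i) = ε * y ^ i := by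
    obtain ⟨i, rfl⟩ := Nat.exists_eq_succ_of_ne_zero hi.ne'
    rw [Nat.succ_eq_add_one, show m + (i + 1) = m + 1 + i by ring, pow_add, hy]
    ring
  have hdvd (b : F) (hb : b ∈ B) : (X - C b) ^ u ∣ P := by
    rw [X_sub_C_pow_dvd_iff, X_pow_dvd_iff]
    intro l hl
    have hcomp : P.comp (X + C b) =
        ∑ a ∈ A, C (w a) * (X + C (a + b)) ^ (m + u) - C ε := by
      simp only [hP, sub_comp, Polynomial.sum_comp, Polynomial.mul_comp, C_comp, pow_comp, add_comp, X_comp,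
        C_add]
      simp only [add_assoc, add_comm (C b)]
    simp only [hcomp, coeff_sub, finsetSum_coeff, coeff_C_mul, coeff_X_add_C_pow, coeff_C]
    have hterm : ∀ a ∈ A, w a * ((a + b) ^ (m + u - l) * ((m + u).choose l : F)) =
        w a * (a + b) ^ (u - l) * (ε * ((m + u).choose l : F)) := by
      intro a ha
      rw [show m + u - l = m + (u - l) by omega,
        hpow _ (h a ha b hb) _ (by omega)]
      ring
    rw [Finset.sum_congr rfl hterm, ← Finset.sum_mul, hw b _ (by omega)]
    rcases Nat.eq_zero_or_pos l with rfl | hl0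
    · simp
    · simp [hl0.ne', show u - l ≠ u by omega]
  have hprod : ∏ b ∈ B, (X - C b) ^ u ∣ P := by
    refine Finset.prod_dvd_of_coprime (fun a _ b _ hab => ?_) hdvd
    exact (isCoprime_X_sub_C_of_isUnit_sub (sub_ne_zero.mpr hab).isUnit).pow
  have hdeg := natDegree_le_of_dvd hprod hP0
  rw [natDegree_prod_of_monic _ _ fun b _ => (monic_X_sub_C b).pow u] at hdeg
  simp only [natDegree_pow, natDegree_X_sub_C, mul_one, Finset.sum_const, smul_eq_mul] at hdeg
  exact hdeg.trans hPdeg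

/-- A progression of `2 * u` terms modulo `p` consisting of `k`-th powers has `u ^ 2 ≤ m`, where
`m = (p - 1) / k`. -/
theorem mul_self_le_of_forall_isPow {p k m b c u : ℕ} [Fact p.Prime] (hkm : k * m = p - 1)
    (hm : 0 < m) (hmu : m + u < p) (hpb : ¬ p ∣ b)
    (h : ∀ n < 2 * u, ∃ x : ZMod p, x ^ k = ((b * n + c : ℕ) : ZMod p)) :
    u * u ≤ m := by
  classical
  have hb : (b : ZMod p) ≠ 0 := by rwa [Ne, ZMod.natCast_eq_zero_iff]
  have hcast : Set.InjOn (Nat.cast : ℕ → ZMod p) (Set.Iio p) := fun i hi j hj hij => by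
    have := (ZMod.natCast_eq_natCast_iff' i j p).mp hij
    rwa [Nat.mod_eq_of_lt hi, Nat.mod_eq_of_lt hj] at this
  set A : Finset (ZMod p) := (Finset.range (u + 1)).image Nat.cast with hAdef
  set B : Finset (ZMod p) := (Finset.range u).image fun j : ℕ => (j : ZMod p) + c / b with hBdef
  have hA : A.card = u + 1 := by
    rw [hAdef, Finset.card_image_of_injOn, Finset.card_range]
    refine hcast.mono fun i hi => ?_
    simp only [Finset.coe_range, Set.mem_Iio] at hi ⊢
    omega
  have hB : B.card = u := by
    rw [hBdef, Finset.card_image_of_injOn, Finset.card_range]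
    intro i hi j hj hij
    simp only [Finset.coe_range, Set.mem_Iio] at hi hj
    exact hcast (Set.mem_Iio.mpr (by omega)) (Set.mem_Iio.mpr (by omega)) (add_right_cancel hij)
  have hchoose : ((m + u).choose m : ZMod p) ≠ 0 := by
    rw [Ne, ZMod.natCast_eq_zero_iff]
    exact (Fact.out : p.Prime).coprime_iff_not_dvd.mp
      ((Fact.out : p.Prime).coprime_choose_of_lt hmu (Nat.le_add_right m u))
  have key := mul_card_le_of_add_pow_succ (ε := ((b : ZMod p) ^ m)⁻¹) (A := A) (B := B) hm hA
    hchoose ?_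
  · rwa [hB] at key
  intro y hy z hz
  simp only [hAdef, hBdef, Finset.mem_image, Finset.mem_range] at hy hz
  obtain ⟨i, hi, rfl⟩ := hy
  obtain ⟨j, hj, rfl⟩ := hz
  obtain ⟨x, hx⟩ := h (i + j) (by omega)
  have hxb : (i : ZMod p) + (j + c / b) = x ^ k / b := by
    rw [hx]
    push_cast
    field_simp
    ring
  rw [hxb]
  have hxp : (x ^ k) ^ (m + 1) = x ^ k := by
    rcases eq_or_ne x 0 with rfl | hx0
    · have hk : k ≠ 0 := by
        rintro rfl
        have := (Fact.out : p.Prime).two_le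
        omega
      simp [hk]
    · rw [pow_succ, ← pow_mul, hkm, ZMod.pow_card_sub_one_eq_one hx0, one_mul]
  rw [div_pow, hxp, pow_succ]
  field_simp

/-- The least k-th power non-residue in the arithmetic progression {bn + c} over F_p
(assuming one exists) is at most (7/√5)·b·√((p-1)/k) + 4b + c. -/
theorem least_power_nonresidue_in_AP (p k b c : ℕ) (hp : p.Prime) (hk : k ∣ p - 1)
    (hb : 0 < b) (hc : 0 < c) (hpb : ¬ p ∣ b)
    (hex : ∃ n : ℕ, ¬ ∃ x : ZMod p, x ^ k = ((b * n + c : ℕ) : ZMod p)) :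
    ∃ n : ℕ, (¬ ∃ x : ZMod p, x ^ k = ((b * n + c : ℕ) : ZMod p)) ∧
      ((b * n + c : ℕ) : ℝ) ≤
        7 / Real.sqrt 5 * b * Real.sqrt (((p : ℝ) - 1) / k) + 4 * b + c := by
  have := Fact.mk hp
  obtain ⟨m, hkm⟩ := hk
  have hp2 := hp.two_le
  have hk0 : 0 < k := Nat.pos_of_ne_zero fun h => by subst h; omega
  have hm : 0 < m := Nat.pos_of_ne_zero fun h => by subst h; omega
  have hk1 : k ≠ 1 := by
    rintro rfl
    obtain ⟨n, hn⟩ := hex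
    exact hn ⟨_, pow_one _⟩
  have hk2 : 2 ≤ k := by omega
  have hquot : ((p : ℝ) - 1) / k = m := by
    have : ((p - 1 : ℕ) : ℝ) = k * m := by rw [hkm]; push_cast; ring
    rw [Nat.cast_sub hp.one_le, Nat.cast_one] at this
    rw [this]
    field_simp
  rw [hquot]
  have hsqrt : (2 : ℝ) ≤ 7 / √5 := by
    rw [le_div_iff₀ (by positivity)]
    have : √5 ≤ 7 / 2 := Real.sqrt_le_iff.mpr (by norm_num)
    linarith
  have hbR : (0 : ℝ) < b := by exact_mod_cast hb
  suffices H : ∃ n : ℕ, (¬ ∃ x : ZMod p, x ^ k = ((b * n + c : ℕ) : ZMod p)) ∧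
      n ≤ 2 * m.sqrt + 4 by
    obtain ⟨n, hn, hle⟩ := H
    refine ⟨n, hn, ?_⟩
    have hle' : (n : ℝ) ≤ 2 * √m + 4 := by
      have h1 : (n : ℝ) ≤ 2 * m.sqrt + 4 := by exact_mod_cast hle
      have h2 : (m.sqrt : ℝ) ≤ √m := Real.nat_sqrt_le_real_sqrt
      linarith
    have h3 : 2 * √(m : ℝ) ≤ 7 / √5 * √m := by gcongr
    push_cast
    nlinarith
  rcases le_or_gt p 4 with hp4 | hp4
  · obtain ⟨n, hn⟩ := hex
    refine ⟨n % p, ?_, by have := Nat.mod_lt n hp.pos; omega⟩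
    simpa using hn
  · by_contra! hall
    have hsq : m.sqrt ≤ m := Nat.sqrt_le_self m
    have hmu : m + (m.sqrt + 1) < p := by
      rcases eq_or_ne m 1 with rfl | hm1
      · rw [Nat.sqrt_one]; omega
      · have : m.sqrt < m := Nat.sqrt_lt_self (by omega)
        have : 2 * m ≤ k * m := Nat.mul_le_mul_right m hk2
        omega
    have := mul_self_le_of_forall_isPow (c := c) (u := m.sqrt + 1) hkm.symm hm hmu hpb fun n hn => by
      by_contra hn'
      exact absurd (hall n (by push Not at hn'; exact hn')) (by omega)
    exact absurd (Nat.lt_succ_sqrt m) (by simpa using this)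
end

section
/- Let T, d, D = d+1, r be positive integers with D·r = D + T, let a_1, ..., a_r be pairwise distinct elements of a field of characteristic zero (or sufficiently large characteristic). Then the Dr polynomials {x^j (x + a_i)^T : 1 ≤ i ≤ r, 0 ≤ j ≤ d} are linearly independent over the field. -/
open Polynomial in
/-- If the entries of column `j` have degree at most `e j`, the determinant has degree at most
`∑ j, e j`, and its coefficient there is the determinant of the coefficients. -/
theorem Polynomial.natDegree_det_le_and_coeff_det {R : Type*} [CommRing R] {n : ℕ}
    (M : Matrix (Fin n) (Fin n) R[X]) (e : Fin n → ℕ) (hM : ∀ k j, (M k j).natDegree ≤ e j) :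
    M.det.natDegree ≤ ∑ j, e j ∧
      M.det.coeff (∑ j, e j) = (Matrix.of fun k j => (M k j).coeff (e j)).det := by
  have key : ∀ (σ : Equiv.Perm (Fin n)) (s : Finset (Fin n)),
      (∏ j ∈ s, M (σ j) j).natDegree ≤ ∑ j ∈ s, e j ∧
      (∏ j ∈ s, M (σ j) j).coeff (∑ j ∈ s, e j) = ∏ j ∈ s, (M (σ j) j).coeff (e j) := by
    intro σ s
    induction s using Finset.induction_on with
    | empty => simp
    | insert a s ha ih =>
      rw [Finset.prod_insert ha, Finset.sum_insert ha, Finset.prod_insert ha]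
      exact ⟨natDegree_mul_le.trans (add_le_add (hM _ _) ih.1), by
        rw [coeff_mul_add_eq_of_natDegree_le (hM _ _) ih.1, ih.2]⟩
  rw [Matrix.det_apply', Matrix.det_apply']
  constructor
  · refine natDegree_sum_le_of_forall_le _ _ fun σ _ => ?_
    refine natDegree_mul_le.trans ?_
    rw [natDegree_intCast, zero_add]
    exact (key σ _).1
  · simp only [finsetSum_coeff, Matrix.of_apply]
    refine Finset.sum_congr rfl fun σ _ => ?_
    rw [coeff_intCast_mul, (key σ _).2]

open Polynomial in
theorem Polynomial.natDegree_X_pow_mul_iterate_derivative_le {R : Type*} [CommRing R]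
    (p : R[X]) (k : ℕ) : (X ^ k * derivative^[k] p).natDegree ≤ p.natDegree := by
  rw [natDegree_le_iff_coeff_eq_zero]
  intro m hm
  rw [coeff_X_pow_mul']
  split_ifs with h
  · rw [coeff_iterate_derivative, Nat.sub_add_cancel h, coeff_eq_zero_of_natDegree_lt hm, smul_zero]
  · rfl

open Polynomial in
theorem Polynomial.coeff_X_pow_mul_iterate_derivative {R : Type*} [CommRing R]
    (p : R[X]) (k m : ℕ) :
    (X ^ k * derivative^[k] p).coeff m = p.coeff m * (m.descFactorial k : R) := by
  rw [coeff_X_pow_mul']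
  split_ifs with h
  · rw [coeff_iterate_derivative, Nat.sub_add_cancel h, nsmul_eq_mul, mul_comm]
  · rw [Nat.descFactorial_of_lt (not_le.mp h), Nat.cast_zero, mul_zero]

open Polynomial in
/-- The Wronskian matrix of a finite sequence of polynomials. -/
noncomputable def Polynomial.wronskianMatrix {R : Type*} [CommRing R] {n : ℕ} (g : Fin n → R[X]) :
    Matrix (Fin n) (Fin n) R[X] :=
  Matrix.of fun k j => derivative^[(k : ℕ)] (g j)

open Polynomial in
/-- The Wronskian of nonzero polynomials of distinct degrees is nonzero, and its degree is bounded
by the sum of the degrees minus `0 + 1 + ⋯ + (n - 1)`. -/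
theorem Polynomial.det_wronskianMatrix_ne_zero_and_natDegree_le {F : Type*} [Field F] [CharZero F]
    {n : ℕ} (g : Fin n → F[X]) (hg : ∀ j, g j ≠ 0)
    (hinj : Function.Injective fun j => (g j).natDegree) :
    (wronskianMatrix g).det ≠ 0 ∧
      (wronskianMatrix g).det.natDegree + ∑ j : Fin n, (j : ℕ) ≤ ∑ j, (g j).natDegree := by
  obtain ⟨hdeg, hcoeff⟩ := natDegree_det_le_and_coeff_det
    (Matrix.of fun k j => X ^ (k : ℕ) * wronskianMatrix g k j) (fun j => (g j).natDegree)
    (fun k j => natDegree_X_pow_mul_iterate_derivative_le _ _)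
  rw [Matrix.det_mul_column, Finset.prod_pow_eq_pow_sum] at hdeg hcoeff
  have hne : (wronskianMatrix g).det ≠ 0 := by
    intro h0
    rw [h0, mul_zero, coeff_zero] at hcoeff
    have hmat : (Matrix.of fun k j : Fin n =>
        (Matrix.of (fun k j : Fin n => X ^ (k : ℕ) * wronskianMatrix g k j) k j).coeff (g j).natDegree) =
        Matrix.of fun k j => (g j).leadingCoeff *
          (Matrix.of fun i j : Fin n =>
            (descPochhammer F j).eval ((g i).natDegree : F)).transpose k j := by
      ext k j
      simp only [Matrix.of_apply, wronskianMatrix, Matrix.transpose_apply,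
        descPochhammer_eval_eq_descFactorial, coeff_X_pow_mul_iterate_derivative, leadingCoeff]
    rw [hmat, Matrix.det_mul_row, Matrix.det_transpose,
      ← Matrix.det_eval_matrixOfPolynomials_eq_det_vandermonde _ _
        (fun i => descPochhammer_natDegree F i) (fun i => monic_descPochhammer F i)] at hcoeff
    refine mul_ne_zero (Finset.prod_ne_zero_iff.mpr fun j _ => leadingCoeff_ne_zero.mpr (hg j))
      (Matrix.det_vandermonde_ne_zero_iff.mpr ?_) hcoeff.symm
    exact fun i j hij => hinj (Nat.cast_injective hij)
  refine ⟨hne, ?_⟩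
  rwa [natDegree_X_pow_mul _ hne] at hdeg

open Polynomial in
/-- Replacing a column by the one of a linear combination scales the Wronskian. -/
theorem Polynomial.det_updateCol_wronskianMatrix {R : Type*} [CommRing R] {n : ℕ}
    (g : Fin n → R[X]) (c : Fin n → R) (j : Fin n) :
    ((wronskianMatrix g).updateCol j
      (fun k => derivative^[(k : ℕ)] (∑ i, c i • g i))).det =
      C (c j) * (wronskianMatrix g).det := by
  rw [← smul_eq_mul, ← Matrix.det_updateCol_sum _ j (fun i => C (c i))]
  congr 2
  ext1 k
  simp [wronskianMatrix, iterate_derivative_sum, smul_eq_C_mul]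

open Polynomial in
theorem Polynomial.linearIndependent_of_det_wronskianMatrix_ne_zero {F : Type*} [Field F] {n : ℕ}
    (g : Fin n → F[X]) (hW : (wronskianMatrix g).det ≠ 0) : LinearIndependent F g := by
  rw [Fintype.linearIndependent_iff]
  intro c hc j
  have h := det_updateCol_wronskianMatrix g c j
  rw [hc, Matrix.det_eq_zero_of_column_eq_zero j (by simp)] at h
  simpa [hW] using h.symm

open Polynomial in
/-- If a nonzero linear combination of `g` is divisible by `p ^ T`, then the Wronskian of `g` is
divisible by `p ^ (T + 1 - n)`. -/
theorem Polynomial.pow_dvd_det_wronskianMatrix {F : Type*} [Field F] {n : ℕ}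
    (g : Fin n → F[X]) {f p : F[X]} {T : ℕ} (hf : f ∈ Submodule.span F (Set.range g))
    (hf0 : f ≠ 0) (hp : p ^ T ∣ f) : p ^ (T + 1 - n) ∣ (wronskianMatrix g).det := by
  obtain ⟨c, rfl⟩ := (Submodule.mem_span_range_iff_exists_fun F).mp hf
  obtain ⟨j, hj⟩ : ∃ j, c j ≠ 0 := by
    by_contra! h
    exact hf0 (by simp [h])
  have hu : IsUnit (C (c j)) := isUnit_C.mpr hj.isUnit
  rw [← hu.dvd_mul_left, ← det_updateCol_wronskianMatrix, Matrix.det_apply']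
  refine Finset.dvd_sum fun σ _ => Dvd.dvd.mul_left ?_ _
  refine dvd_trans ?_ (Finset.dvd_prod_of_mem _ (Finset.mem_univ j))
  rw [Matrix.updateCol_self]
  refine (pow_dvd_pow _ ?_).trans (pow_sub_dvd_iterate_derivative_of_pow_dvd _ hp)
  have := (σ j).isLt
  omega

open Polynomial in
/-- A space of polynomials of bounded degree is spanned by polynomials of distinct degrees. -/
theorem Polynomial.exists_strictMono_natDegree_span {F : Type*} [Field F] (V : Submodule F F[X])
    (N : ℕ) (hV : ∀ f ∈ V, f.natDegree ≤ N) :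
    ∃ (n : ℕ) (g : Fin n → F[X]), (∀ j, g j ∈ V) ∧ (∀ j, g j ≠ 0) ∧
      StrictMono (fun j => (g j).natDegree) ∧ V ≤ Submodule.span F (Set.range g) := by
  classical
  set E : Finset ℕ := (Finset.range (N + 1)).filter fun m => ∃ f ∈ V, f ≠ 0 ∧ f.natDegree = m
    with hE
  have hmem : ∀ j : Fin E.card, ∃ f ∈ V, f ≠ 0 ∧ f.natDegree = E.orderEmbOfFin rfl j := fun j =>
    (Finset.mem_filter.mp (E.orderEmbOfFin_mem rfl j)).2
  choose g hgV hg0 hgdeg using hmem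
  refine ⟨E.card, g, hgV, hg0, fun i j hij => ?_, fun f hf => ?_⟩
  · simpa only [hgdeg] using (E.orderEmbOfFin rfl).strictMono hij
  · induction hm : f.degree using WellFoundedLT.induction generalizing f with
    | ind m ih =>
      subst hm
      by_cases hf0 : f = 0
      · rw [hf0]; exact zero_mem _
      have hfE : f.natDegree ∈ E :=
        Finset.mem_filter.mpr ⟨Finset.mem_range_succ_iff.mpr (hV f hf), f, hf, hf0, rfl⟩
      obtain ⟨j, hj⟩ : f.natDegree ∈ Set.range (E.orderEmbOfFin rfl) := by
        rw [Finset.range_orderEmbOfFin]; exact hfE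
      set c := f.leadingCoeff / (g j).leadingCoeff with hc
      have hlc : (g j).leadingCoeff ≠ 0 := leadingCoeff_ne_zero.mpr (hg0 j)
      have hc0 : c ≠ 0 := div_ne_zero (leadingCoeff_ne_zero.mpr hf0) hlc
      have hlt : (f - c • g j).degree < f.degree := by
        refine degree_sub_lt_left ?_ hf0 ?_
        · rw [smul_eq_C_mul, degree_C_mul hc0, degree_eq_natDegree hf0,
            degree_eq_natDegree (hg0 j), hgdeg, hj]
        · rw [smul_eq_C_mul, leadingCoeff_mul, leadingCoeff_C, hc, div_mul_cancel₀ _ hlc]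
      have := ih _ hlt (f - c • g j) (V.sub_mem hf (V.smul_mem _ (hgV j))) rfl
      rw [← sub_add_cancel f (c • g j)]
      exact add_mem this (Submodule.smul_mem _ _ (Submodule.subset_span ⟨j, rfl⟩))

theorem StrictMono.apply_add_card_le {n N : ℕ} {e : Fin n → ℕ} (he : StrictMono e)
    (hN : ∀ j, e j ≤ N) (j : Fin n) : e j + (n - 1) ≤ N + j := by
  have h := Finset.card_le_card_of_injOn (s := Finset.Ioi j) (t := Finset.Ioc (e j) N) e
    (fun i hi => by
      simpa using ⟨he (by simpa using hi), hN i⟩) he.injective.injOn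
  rw [Fin.card_Ioi, Nat.card_Ioc] at h
  have := hN j
  omega

open Polynomial in
/-- Nonzero polynomials of degree at most `N`, the `i`-th one divisible by `(X + a i) ^ T`, satisfy
a degree inequality in terms of the dimension `n` of their span. -/
theorem Polynomial.exists_card_mul_add_le_of_pow_dvd {F ι : Type*} [Field F] [CharZero F]
    (V : Submodule F F[X]) [FiniteDimensional F V] (N T : ℕ) (hV : ∀ f ∈ V, f.natDegree ≤ N)
    (s : Finset ι) (a : ι → F) (ha : Function.Injective a) (f : ι → F[X])
    (hfV : ∀ i ∈ s, f i ∈ V) (hf0 : ∀ i ∈ s, f i ≠ 0)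
    (hdvd : ∀ i ∈ s, (X + C (a i)) ^ T ∣ f i) :
    ∃ n ≤ Module.finrank F V, s.card * (T + 1 - n) + n * (n - 1) ≤ n * N := by
  obtain ⟨n, g, hgV, hg0, hmono, hspan⟩ := exists_strictMono_natDegree_span V N hV
  obtain ⟨hW, hdeg⟩ := det_wronskianMatrix_ne_zero_and_natDegree_le g hg0 hmono.injective
  refine ⟨n, ?_, ?_⟩
  · have hli : LinearIndependent F (fun j => (⟨g j, hgV j⟩ : V)) :=
      LinearIndependent.of_comp V.subtype (linearIndependent_of_det_wronskianMatrix_ne_zero g hW)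
    simpa using hli.fintype_card_le_finrank
  have hprod : ∏ i ∈ s, (X + C (a i)) ^ (T + 1 - n) ∣ (wronskianMatrix g).det := by
    refine Finset.prod_dvd_of_coprime (fun i _ j _ hij => ?_) fun i hi =>
      pow_dvd_det_wronskianMatrix g (hspan (hfV i hi)) (hf0 i hi) (hdvd i hi)
    have := pairwise_coprime_X_sub_C (s := fun i => -a i) (fun x y h => ha (neg_injective h)) hij
    simp only [C_neg, sub_neg_eq_add] at this
    exact this.pow
  have hle := natDegree_le_of_dvd hprod hW
  rw [natDegree_prod _ _ fun i _ => pow_ne_zero _ (X_add_C_ne_zero _)] at hle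
  simp only [natDegree_pow, natDegree_X_add_C, mul_one, Finset.sum_const, smul_eq_mul] at hle
  have hsum := Finset.sum_le_sum fun (j : Fin n) (_ : j ∈ Finset.univ) =>
    hmono.apply_add_card_le (fun j => hV _ (hgV j)) j
  simp only [Finset.sum_add_distrib, Finset.sum_const, Finset.card_univ, Fintype.card_fin,
    smul_eq_mul] at hsum
  omega

open Polynomial in
/-- The Dr polynomials x^j (x + a_i)^T (1 ≤ i ≤ r, 0 ≤ j ≤ d) are linearly
independent when the a_i are distinct, D = d+1 and D·r = D + T. -/
theorem sylvester_vandermonde_linear_independent {F : Type*} [Field F] [CharZero F]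
    (T d r D : ℕ) (hD : D = d + 1) (hDr : D * r = D + T) (hT : 0 < T) (hr : 0 < r)
    (a : Fin r → F) (ha : Function.Injective a) :
    LinearIndependent F
      (fun ij : Fin r × Fin D => (X ^ (ij.2 : ℕ) * (X + C (a ij.1)) ^ T : F[X])) := by
  classical
  rw [Fintype.linearIndependent_iff]
  intro c hc
  set q : Fin r → F[X] := fun i => ∑ j : Fin D, C (c (i, j)) * X ^ (j : ℕ) with hq
  set f : Fin r → F[X] := fun i => q i * (X + C (a i)) ^ T with hf
  have hsum : ∑ i, f i = 0 := by
    rw [← hc, Fintype.sum_prod_type]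
    refine Finset.sum_congr rfl fun i _ => ?_
    simp only [hf, hq, Finset.sum_mul, smul_eq_C_mul, mul_assoc]
  have hqdeg : ∀ i, (q i).natDegree ≤ d := fun i =>
    natDegree_sum_le_of_forall_le _ _ fun j _ =>
      (natDegree_C_mul_X_pow_le _ _).trans (by have := j.isLt; omega)
  have hfdeg : ∀ i, (f i).natDegree ≤ T + d := fun i => by
    refine natDegree_mul_le.trans ?_
    rw [natDegree_pow, natDegree_X_add_C]
    have := hqdeg i
    omega
  suffices hq0 : ∀ i, q i = 0 by
    rintro ⟨i, j⟩
    have := congrArg (fun p => coeff p (j : ℕ)) (hq0 i)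
    simpa [hq, finsetSum_coeff, coeff_C_mul, coeff_X_pow, Fin.val_inj] using this
  by_contra! ⟨i₀, hi₀⟩
  set s : Finset (Fin r) := Finset.univ.filter fun i => q i ≠ 0 with hs
  have hi₀s : i₀ ∈ s := by simp [hs, hi₀]
  set V : Submodule F F[X] := Submodule.span F (((s.erase i₀).image f : Finset F[X]) : Set F[X])
    with hVdef
  have hVdeg : ∀ p ∈ V, p.natDegree ≤ T + d := by
    have hle : V ≤ degreeLE F ((T + d : ℕ) : WithBot ℕ) := by
      refine Submodule.span_le.mpr fun p hp => ?_
      obtain ⟨i, -, rfl⟩ := Finset.mem_image.mp (Finset.mem_coe.mp hp)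
      exact mem_degreeLE.mpr (natDegree_le_iff_degree_le.mp (hfdeg i))
    exact fun p hp => natDegree_le_iff_degree_le.mpr (mem_degreeLE.mp (hle hp))
  have herase : ∀ i ∈ s.erase i₀, f i ∈ V := fun i hi =>
    Submodule.subset_span (Finset.mem_coe.mpr (Finset.mem_image_of_mem f hi))
  have hfV : ∀ i ∈ s, f i ∈ V := by
    intro i hi
    by_cases h : i = i₀
    · have hs0 : ∑ i ∈ s, f i = 0 := by
        rw [← hsum]
        refine Finset.sum_subset (Finset.subset_univ s) fun j _ hj => ?_
        have : q j = 0 := by simpa [hs] using hj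
        simp [hf, this]
      rw [← Finset.add_sum_erase s f hi₀s] at hs0
      rw [h, eq_neg_of_add_eq_zero_left hs0]
      exact neg_mem (sum_mem herase)
    · exact herase i (Finset.mem_erase.mpr ⟨h, hi⟩)
  obtain ⟨n, hn, hle⟩ := exists_card_mul_add_le_of_pow_dvd V (T + d) T hVdeg s a ha f hfV
    (fun i hi => mul_ne_zero (by simpa [hs] using hi) (pow_ne_zero _ (X_add_C_ne_zero _)))
    (fun i _ => dvd_mul_left _ _)
  have hns : n + 1 ≤ s.card := by
    have h1 : Module.finrank F V ≤ (s.erase i₀).card :=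
      (finrank_span_finset_le_card _).trans Finset.card_image_le
    have h2 := Finset.card_erase_add_one hi₀s
    omega
  have hsr : s.card ≤ r := by simpa using Finset.card_le_univ s
  obtain ⟨r, rfl⟩ : ∃ r', r = r' + 1 := ⟨r - 1, by omega⟩
  have hT' : T = (d + 1) * r := by subst hD; linarith
  have hnT : (d + 1) * n ≤ T := by rw [hT']; exact Nat.mul_le_mul_left _ (by omega)
  have hle' := (Nat.add_le_add_right (Nat.mul_le_mul_right (T + 1 - n) hns) _).trans hle
  have hnT' : n ≤ T := (Nat.le_mul_of_pos_left n d.succ_pos).trans hnT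
  obtain ⟨m, hm⟩ : ∃ m, T + 1 = m + n := ⟨T + 1 - n, by omega⟩
  rw [hm, Nat.add_sub_cancel] at hle'
  rcases n with _ | n
  · omega
  · have hTm : T = m + n := by omega
    rw [Nat.add_sub_cancel, hTm] at hle'
    nlinarith
end
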